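/- arXiv:1811.10383 — 2 statements merged into one kernel-verified Lean document; each statement's English description precedes it below -/
import Mathlib

section
/- Thin Morse rectangles: for every Morse gauge N and every D ≥ 0 there exists δ ≥ 0 such that the following holds. Let X be a proper geodesic metric space and x, y, z₁, z₂ ∈ X with d(x,y) ≤ D. Suppose γ₁ is an N-Morse geodesic segment from x to z₁, γ₂ is an N-Morse geodesic segment from y to z₂, γ₃ is a geodesic segment from z₁ to z₂, and γ₄ is a geodesic segment from x to y. Then the quadrilateral is δ-thin: the image of each of γ₁, γ₂, γ₃, γ₄ is contained in the closed δ-neighborhood of the union of the images of the other three. -/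
/-- A *geodesic segment* from `x` to `y`. -/
def IsGeodesicSegment {X : Type*} [MetricSpace X] (γ : ℝ → X) (x y : X) : Prop :=
  γ 0 = x ∧ γ (dist x y) = y ∧
    ∀ s ∈ Set.Icc (0 : ℝ) (dist x y), ∀ t ∈ Set.Icc (0 : ℝ) (dist x y),
      dist (γ s) (γ t) = |s - t|

/-- A metric space is *geodesic* if every pair of points is joined by a geodesic segment. -/
def IsGeodesicSpace (X : Type*) [MetricSpace X] : Prop :=
  ∀ x y : X, ∃ γ : ℝ → X, IsGeodesicSegment γ x y

/-- A *geodesic ray*. -/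
def IsGeodesicRay {X : Type*} [MetricSpace X] (c : ℝ → X) : Prop :=
  ∀ s t : ℝ, 0 ≤ s → 0 ≤ t → dist (c s) (c t) = |s - t|

/-- A `(lam, eps)`-quasi-geodesic defined on `[a, b]`. -/
def IsQuasiGeodesicOn {X : Type*} [MetricSpace X] (lam eps a b : ℝ) (σ : ℝ → X) : Prop :=
  ∀ s ∈ Set.Icc a b, ∀ t ∈ Set.Icc a b,
    |s - t| / lam - eps ≤ dist (σ s) (σ t) ∧ dist (σ s) (σ t) ≤ lam * |s - t| + eps

/-- A *Morse gauge* is a function `[1,∞) × [0,∞) → [0,∞)`. -/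
def IsMorseGauge (N : ℝ → ℝ → ℝ) : Prop :=
  ∀ lam eps : ℝ, 1 ≤ lam → 0 ≤ eps → 0 ≤ N lam eps

/-- A subset `A` of `X` (the image of a geodesic) is *`N`-Morse* if every
`(lam, eps)`-quasi-geodesic with endpoints on `A` stays in the closed
`N lam eps`-neighborhood of `A`. -/
def IsMorseSet {X : Type*} [MetricSpace X] (N : ℝ → ℝ → ℝ) (A : Set X) : Prop :=
  ∀ (lam eps a b : ℝ) (σ : ℝ → X), 1 ≤ lam → 0 ≤ eps → a ≤ b →
    IsQuasiGeodesicOn lam eps a b σ → σ a ∈ A → σ b ∈ A →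
    ∀ s ∈ Set.Icc a b, Metric.infDist (σ s) A ≤ N lam eps

/-- The image of a geodesic segment from `x` to `y`. -/
def segImage {X : Type*} [MetricSpace X] (γ : ℝ → X) (x y : X) : Set X :=
  γ '' Set.Icc (0 : ℝ) (dist x y)

open Set Metric

lemma tmr_concat {X : Type*} [MetricSpace X] (α β : ℝ → X) (L1 L2 : ℝ) (h1 : 0 ≤ L1) (h2 : 0 ≤ L2)
    (hα : ∀ s ∈ Icc 0 L1, ∀ t ∈ Icc 0 L1, dist (α s) (α t) = |s - t|)
    (hβ : ∀ s ∈ Icc 0 L2, ∀ t ∈ Icc 0 L2, dist (β s) (β t) = |s - t|)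
    (hab : α L1 = β 0) (hn : ∀ v ∈ Icc 0 L2, L1 ≤ dist (α 0) (β v)) :
    IsQuasiGeodesicOn 3 0 0 (L1 + L2) (fun s => if s ≤ L1 then α s else β (s - L1)) := by
  have key : ∀ s t, 0 ≤ s → s ≤ L1 → L1 < t → t ≤ L1 + L2 →
      (t - s) / 3 ≤ dist (α s) (β (t - L1)) ∧ dist (α s) (β (t - L1)) ≤ t - s := by
    intro s t hs hs1 ht ht1
    have a1 := hα s ⟨hs, hs1⟩ L1 ⟨h1, le_rfl⟩
    have a2 := hβ 0 ⟨le_rfl, h2⟩ (t - L1) ⟨by linarith, by linarith⟩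
    have a3 := hα 0 ⟨le_rfl, h1⟩ s ⟨hs, hs1⟩
    have a4 := hn (t - L1) ⟨by linarith, by linarith⟩
    rw [abs_of_nonpos (by linarith)] at a1 a2 a3
    rw [hab] at a1
    have t1 := dist_triangle (α s) (β 0) (β (t - L1))
    have t2 := dist_triangle (α 0) (α s) (β (t - L1))
    have t3 := dist_triangle_left (β 0) (β (t - L1)) (α s)
    constructor <;> linarith
  intro s hs t ht
  dsimp only
  by_cases c1 : s ≤ L1 <;> by_cases c2 : t ≤ L1
  · rw [if_pos c1, if_pos c2, hα s ⟨hs.1, c1⟩ t ⟨ht.1, c2⟩]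
    have := abs_nonneg (s - t)
    constructor <;> linarith
  · rw [if_pos c1, if_neg c2]
    have := key s t hs.1 c1 (by linarith) ht.2
    rw [abs_of_nonpos (by linarith)]
    constructor <;> linarith
  · rw [if_neg c1, if_pos c2, dist_comm]
    have := key t s ht.1 c2 (by linarith) hs.2
    rw [abs_of_nonneg (by linarith)]
    constructor <;> linarith
  · rw [if_neg c1, if_neg c2, hβ _ ⟨by linarith, by linarith [hs.2]⟩ _ ⟨by linarith, by linarith [ht.2]⟩]
    have := abs_nonneg (s - t)
    rw [show s - L1 - (t - L1) = s - t by ring]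
    constructor <;> linarith

lemma tmr_update {X : Type*} [MetricSpace X] (σ : ℝ → X) (b D : ℝ) (y : X)
    (hσ : IsQuasiGeodesicOn 3 0 0 b σ) (hD : dist (σ 0) y ≤ D) :
    IsQuasiGeodesicOn 3 D 0 b (Function.update σ 0 y) := by
  have hD0 : 0 ≤ D := dist_nonneg.trans hD
  intro s hs t ht
  have h := hσ s hs t ht
  by_cases c1 : s = 0 <;> by_cases c2 : t = 0
  · subst c1 c2; simp [hD0]
  · subst c1
    rw [Function.update_self, Function.update_of_ne c2]
    have t1 := dist_triangle (σ 0) y (σ t)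
    have t2 := dist_triangle_left y (σ t) (σ 0)
    constructor <;> linarith
  · subst c2
    rw [Function.update_self, Function.update_of_ne c1]
    have t1 := dist_triangle (σ s) y (σ 0)
    have t2 := dist_triangle (σ s) (σ 0) y
    rw [dist_comm y] at t1
    constructor <;> linarith
  · rw [Function.update_of_ne c1, Function.update_of_ne c2]
    constructor <;> linarith

lemma tmr_cont {X : Type*} [MetricSpace X] (γ : ℝ → X) (K a b : ℝ) (hK : 0 ≤ K)
    (h : ∀ s ∈ Icc a b, ∀ t ∈ Icc a b, dist (γ s) (γ t) ≤ K * |s - t|) :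
    ContinuousOn γ (Icc a b) := by
  have : LipschitzOnWith ⟨K, hK⟩ γ (Icc a b) := by
    apply LipschitzOnWith.of_dist_le_mul
    intro s hs t ht
    exact h s hs t ht
  exact this.continuousOn

lemma tmr_back {X : Type*} [MetricSpace X] (γ σ : ℝ → X) (L b C : ℝ) (hb : 0 ≤ b)
    (hγ : ∀ s ∈ Icc 0 L, ∀ t ∈ Icc 0 L, dist (γ s) (γ t) = |s - t|)
    (hσ : IsQuasiGeodesicOn 3 0 0 b σ) (h0 : σ 0 = γ 0) (h1 : σ b = γ L)
    (hC : ∀ s ∈ Icc 0 b, infDist (σ s) (γ '' Icc 0 L) ≤ C) (t : ℝ) (ht : t ∈ Icc 0 L) :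
    ∃ s ∈ Icc 0 b, dist (γ t) (σ s) ≤ 2 * C := by
  have cσ : ContinuousOn σ (Icc 0 b) := tmr_cont σ 3 0 b (by norm_num)
    (fun s hs t ht => by simpa using (hσ s hs t ht).2)
  have cγ : ContinuousOn γ (Icc 0 L) := tmr_cont γ 1 0 L (by norm_num)
    (fun s hs t ht => by simpa using (hγ s hs t ht).le)
  have s1 : Icc 0 t ⊆ Icc 0 L := Icc_subset_Icc_right ht.2
  have s2 : Icc t L ⊆ Icc 0 L := Icc_subset_Icc_left ht.1
  have k1 : IsCompact (γ '' Icc 0 t) := isCompact_Icc.image_of_continuousOn (cγ.mono s1)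
  have k2 : IsCompact (γ '' Icc t L) := isCompact_Icc.image_of_continuousOn (cγ.mono s2)
  have k : IsCompact (γ '' Icc 0 L) := isCompact_Icc.image_of_continuousOn cγ
  have n1 : (γ '' Icc 0 t).Nonempty := (nonempty_Icc.2 ht.1).image _
  have n2 : (γ '' Icc t L).Nonempty := (nonempty_Icc.2 ht.2).image _
  have n : (γ '' Icc 0 L).Nonempty := (nonempty_Icc.2 (ht.1.trans ht.2)).image _
  have cf : ContinuousOn (fun s => infDist (σ s) (γ '' Icc 0 t) - infDist (σ s) (γ '' Icc t L))
      (Icc 0 b) :=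
    ((continuous_infDist_pt _).comp_continuousOn cσ).sub
      ((continuous_infDist_pt _).comp_continuousOn cσ)
  have iv := intermediate_value_Icc hb cf
  have z1 : infDist (σ 0) (γ '' Icc 0 t) = 0 :=
    infDist_zero_of_mem (h0 ▸ ⟨0, ⟨le_rfl, ht.1⟩, rfl⟩)
  have z2 : infDist (σ b) (γ '' Icc t L) = 0 :=
    infDist_zero_of_mem (h1 ▸ ⟨L, ⟨ht.2, le_rfl⟩, rfl⟩)
  obtain ⟨s, hs, hfs⟩ := iv (show (0 : ℝ) ∈ _ from
    ⟨by rw [z1]; linarith [infDist_nonneg (x := σ 0) (s := γ '' Icc t L)],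
     by rw [z2]; linarith [infDist_nonneg (x := σ b) (s := γ '' Icc 0 t)]⟩)
  dsimp only at hfs
  obtain ⟨_, ⟨u1, hu1, rfl⟩, e1⟩ := k1.exists_infDist_eq_dist n1 (σ s)
  obtain ⟨_, ⟨u2, hu2, rfl⟩, e2⟩ := k2.exists_infDist_eq_dist n2 (σ s)
  obtain ⟨_, ⟨u, hu, rfl⟩, e⟩ := k.exists_infDist_eq_dist n (σ s)
  have hCs := hC s hs
  have d1 : dist (σ s) (γ u1) ≤ C ∧ dist (σ s) (γ u2) ≤ C := by
    rcases le_total u t with hut | hut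
    · have := infDist_le_dist_of_mem (x := σ s) (show γ u ∈ γ '' Icc 0 t from ⟨u, ⟨hu.1, hut⟩, rfl⟩)
      constructor <;> linarith
    · have := infDist_le_dist_of_mem (x := σ s) (show γ u ∈ γ '' Icc t L from ⟨u, ⟨hut, hu.2⟩, rfl⟩)
      constructor <;> linarith
  refine ⟨s, hs, ?_⟩
  have g12 := hγ u1 (s1 hu1) u2 (s2 hu2)
  have g1 := hγ t ht u1 (s1 hu1)
  have g2 := hγ t ht u2 (s2 hu2)
  rw [abs_of_nonpos (by linarith [hu1.2, hu2.1])] at g12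
  rw [abs_of_nonneg (by linarith [hu1.2])] at g1
  rw [abs_of_nonpos (by linarith [hu2.1])] at g2
  have t0 := dist_triangle_left (γ u1) (γ u2) (σ s)
  have t1 := dist_triangle_right (γ t) (σ s) (γ u1)
  have t2 := dist_triangle_right (γ t) (σ s) (γ u2)
  linarith

lemma tmr_core {X : Type*} [MetricSpace X] (N : ℝ → ℝ → ℝ) (hN : IsMorseGauge N) (D : ℝ)
    (hX : IsGeodesicSpace X) (x y z₁ z₂ : X) (γ₁ γ₂ γ₃ : ℝ → X) (hD : dist x y ≤ D)
    (h1 : IsGeodesicSegment γ₁ x z₁) (m1 : IsMorseSet N (segImage γ₁ x z₁))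
    (h2 : IsGeodesicSegment γ₂ y z₂) (m2 : IsMorseSet N (segImage γ₂ y z₂))
    (h3 : IsGeodesicSegment γ₃ z₁ z₂) :
    (∀ w ∈ segImage γ₁ x z₁,
      infDist w (segImage γ₂ y z₂ ∪ segImage γ₃ z₁ z₂) ≤ 2 * N 3 0 + N 3 D + D) ∧
    (∀ w ∈ segImage γ₃ z₁ z₂,
      infDist w (segImage γ₁ x z₁ ∪ segImage γ₂ y z₂) ≤ 2 * N 3 0 + N 3 D + D) := by
  have hD0 : 0 ≤ D := dist_nonneg.trans hD
  have N0 := hN 3 0 (by norm_num) le_rfl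
  have N1 := hN 3 D (by norm_num) hD0
  obtain ⟨h10, h1e, h1i⟩ := h1
  obtain ⟨h20, h2e, h2i⟩ := h2
  obtain ⟨h30, h3e, h3i⟩ := h3
  set ℓ := dist z₁ z₂ with hℓ
  have hℓ0 : 0 ≤ ℓ := dist_nonneg
  have c3 : ContinuousOn γ₃ (Icc 0 ℓ) := tmr_cont γ₃ 1 0 ℓ (by norm_num)
    (fun s hs t ht => by simpa using (h3i s hs t ht).le)
  have k3 : IsCompact (segImage γ₃ z₁ z₂) := isCompact_Icc.image_of_continuousOn c3
  have n3 : (segImage γ₃ z₁ z₂).Nonempty := (nonempty_Icc.2 hℓ0).image _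
  obtain ⟨p, ⟨c, hc, hcp⟩, hp⟩ := k3.exists_infDist_eq_dist n3 x
  have near : ∀ v ∈ Icc 0 ℓ, dist x p ≤ dist x (γ₃ v) := fun v hv =>
    hp ▸ infDist_le_dist_of_mem ⟨v, hv, rfl⟩
  obtain ⟨α, α0, αe, αi⟩ := hX x p
  set L := dist x p with hL
  have hL0 : 0 ≤ L := dist_nonneg
  have q1 := tmr_concat α (fun u => γ₃ (c - u)) L c hL0 hc.1 αi
    (fun s hs t ht => by
      rw [h3i _ ⟨by linarith [hs.2], by linarith [hs.1, hc.2]⟩ _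
        ⟨by linarith [ht.2], by linarith [ht.1, hc.2]⟩, ← abs_neg]
      congr 1; ring)
    (by simp [αe, hcp])
    (fun v hv => by rw [α0]; exact near _ ⟨by linarith [hv.2], by linarith [hv.1, hc.2]⟩)
  have q2 := tmr_concat α (fun u => γ₃ (c + u)) L (ℓ - c) hL0 (by linarith [hc.2]) αi
    (fun s hs t ht => by
      rw [h3i _ ⟨by linarith [hs.1, hc.1], by linarith [hs.2]⟩ _
        ⟨by linarith [ht.1, hc.1], by linarith [ht.2]⟩]
      congr 1; ring)
    (by simp [αe, hcp])
    (fun v hv => by rw [α0]; exact near _ ⟨by linarith [hv.1, hc.1], by linarith [hv.2]⟩)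
  set σ1 : ℝ → X := fun s => if s ≤ L then α s else γ₃ (c - (s - L)) with hσ1
  set σ2 : ℝ → X := fun s => if s ≤ L then α s else γ₃ (c + (s - L)) with hσ2
  have σ1v : ∀ u, 0 ≤ u → σ1 (L + u) = γ₃ (c - u) := by
    intro u hu
    rcases hu.eq_or_lt with rfl | hu
    · simp [hσ1, αe, hcp]
    · simp [hσ1, hu]
  have σ2v : ∀ u, 0 ≤ u → σ2 (L + u) = γ₃ (c + u) := by
    intro u hu
    rcases hu.eq_or_lt with rfl | hu
    · simp [hσ2, αe, hcp]
    · simp [hσ2, hu]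
  have σ10 : σ1 0 = x := by simp [hσ1, hL0, α0]
  have σ20 : σ2 0 = x := by simp [hσ2, hL0, α0]
  have σ1e : σ1 (L + c) = z₁ := by rw [σ1v c hc.1, sub_self, h30]
  have σ2e : σ2 (L + (ℓ - c)) = z₂ := by
    rw [σ2v _ (by linarith [hc.2])]; simp [h3e]
  have x1 : x ∈ segImage γ₁ x z₁ := ⟨0, ⟨le_rfl, dist_nonneg⟩, h10⟩
  have z1 : z₁ ∈ segImage γ₁ x z₁ := ⟨_, ⟨dist_nonneg, le_rfl⟩, h1e⟩
  have y2 : y ∈ segImage γ₂ y z₂ := ⟨0, ⟨le_rfl, dist_nonneg⟩, h20⟩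
  have z2 : z₂ ∈ segImage γ₂ y z₂ := ⟨_, ⟨dist_nonneg, le_rfl⟩, h2e⟩
  have M1 := m1 3 0 0 (L + c) σ1 (by norm_num) le_rfl (by linarith [hc.1]) q1
    (by rwa [σ10]) (by rwa [σ1e])
  have M2 : ∀ s ∈ Icc 0 (L + (ℓ - c)), infDist (σ2 s) (segImage γ₂ y z₂) ≤ N 3 D + D := by
    intro s hs
    by_cases h : s = 0
    · subst h
      rw [σ20]
      linarith [infDist_le_dist_of_mem (x := x) y2]
    · have := m2 3 D 0 (L + (ℓ - c)) (Function.update σ2 0 y) (by norm_num) hD0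
        (by linarith [hc.2]) (tmr_update σ2 _ D y q2 (by rwa [σ20])) (by simpa using y2)
        (by
          rw [Function.update_of_ne, σ2e]
          · exact z2
          · exact (lt_of_lt_of_le (lt_of_le_of_ne hs.1 (Ne.symm h)) hs.2).ne') s hs
      rw [Function.update_of_ne h] at this
      linarith
  constructor
  · rintro _ ⟨t, ht, rfl⟩
    obtain ⟨s, hs, hst⟩ := tmr_back γ₁ σ1 (dist x z₁) (L + c) (N 3 0) (by linarith [hc.1]) h1i q1
      (by rw [σ10, h10]) (by rw [σ1e, h1e]) M1 t ht
    have tri := infDist_le_infDist_add_dist (s := segImage γ₂ y z₂ ∪ segImage γ₃ z₁ z₂)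
      (x := γ₁ t) (y := σ1 s)
    rcases le_total s L with h | h
    · have e : σ1 s = σ2 s := by simp [hσ1, hσ2, h]
      have a := M2 s ⟨hs.1, by linarith [hc.2]⟩
      have b := infDist_le_infDist_of_subset (x := σ1 s)
        (subset_union_left (s := segImage γ₂ y z₂) (t := segImage γ₃ z₁ z₂)) ⟨y, y2⟩
      rw [← e] at a
      linarith
    · have e := σ1v (s - L) (by linarith)
      rw [add_sub_cancel] at e
      have b : infDist (σ1 s) (segImage γ₂ y z₂ ∪ segImage γ₃ z₁ z₂) = 0 :=
        infDist_zero_of_mem (Or.inr ⟨c - (s - L), ⟨by linarith [hs.2], by linarith [hc.2]⟩, e.symm⟩)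
      linarith
  · rintro _ ⟨t, ht, rfl⟩
    rcases le_total t c with h | h
    · have e := σ1v (c - t) (by linarith)
      rw [sub_sub_cancel] at e
      have a := M1 (L + (c - t)) ⟨by linarith, by linarith [ht.1]⟩
      have b := infDist_le_infDist_of_subset (x := γ₃ t)
        (subset_union_left (s := segImage γ₁ x z₁) (t := segImage γ₂ y z₂)) ⟨x, x1⟩
      rw [e] at a
      linarith
    · have e := σ2v (t - c) (by linarith)
      rw [add_sub_cancel] at e
      have a := M2 (L + (t - c)) ⟨by linarith, by linarith [ht.2]⟩
      have b := infDist_le_infDist_of_subset (x := γ₃ t)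
        (subset_union_right (s := segImage γ₁ x z₁) (t := segImage γ₂ y z₂)) ⟨y, y2⟩
      rw [e] at a
      linarith

lemma tmr_rev {X : Type*} [MetricSpace X] (γ : ℝ → X) (x y : X) (h : IsGeodesicSegment γ x y) :
    IsGeodesicSegment (fun s => γ (dist x y - s)) y x ∧
    segImage (fun s => γ (dist x y - s)) y x = segImage γ x y := by
  obtain ⟨h0, he, hi⟩ := h
  refine ⟨⟨by simpa using he, by simpa [dist_comm y x] using h0, ?_⟩, ?_⟩
  · intro s hs t ht
    rw [dist_comm y x] at hs ht
    dsimp only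
    rw [hi _ ⟨by linarith [hs.2], by linarith [hs.1]⟩ _
      ⟨by linarith [ht.2], by linarith [ht.1]⟩, ← abs_neg]
    congr 1; ring
  · unfold segImage
    rw [dist_comm y x]
    ext w
    constructor
    · rintro ⟨s, hs, rfl⟩
      exact ⟨_, ⟨by linarith [hs.2], by linarith [hs.1]⟩, rfl⟩
    · rintro ⟨s, hs, rfl⟩
      exact ⟨dist x y - s, ⟨by linarith [hs.2], by linarith [hs.1]⟩, by simp⟩

/-- thin Morse rectangles.  For every Morse gauge `N` and every `D ≥ 0` there is
`δ ≥ 0` such that in any proper geodesic metric space, a geodesic quadrilateral two of whose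
opposite sides are `N`-Morse and whose remaining side `[x,y]` has length at most `D` is
`δ`-thin: each side lies in the closed `δ`-neighborhood of the union of the other three. -/
theorem thin_morse_rectangles (N : ℝ → ℝ → ℝ) (hN : IsMorseGauge N) (D : ℝ) (hD : 0 ≤ D) :
    ∃ δ : ℝ, 0 ≤ δ ∧
      ∀ (X : Type) (_ : MetricSpace X) (_ : ProperSpace X), IsGeodesicSpace X →
        ∀ (x y z₁ z₂ : X) (γ₁ γ₂ γ₃ γ₄ : ℝ → X),
          dist x y ≤ D →
          IsGeodesicSegment γ₁ x z₁ → IsMorseSet N (segImage γ₁ x z₁) →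
          IsGeodesicSegment γ₂ y z₂ → IsMorseSet N (segImage γ₂ y z₂) →
          IsGeodesicSegment γ₃ z₁ z₂ → IsGeodesicSegment γ₄ x y →
          (∀ w ∈ segImage γ₁ x z₁,
            Metric.infDist w (segImage γ₂ y z₂ ∪ segImage γ₃ z₁ z₂ ∪ segImage γ₄ x y) ≤ δ) ∧
          (∀ w ∈ segImage γ₂ y z₂,
            Metric.infDist w (segImage γ₁ x z₁ ∪ segImage γ₃ z₁ z₂ ∪ segImage γ₄ x y) ≤ δ) ∧
          (∀ w ∈ segImage γ₃ z₁ z₂,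
            Metric.infDist w (segImage γ₁ x z₁ ∪ segImage γ₂ y z₂ ∪ segImage γ₄ x y) ≤ δ) ∧
          (∀ w ∈ segImage γ₄ x y,
            Metric.infDist w (segImage γ₁ x z₁ ∪ segImage γ₂ y z₂ ∪ segImage γ₃ z₁ z₂) ≤ δ) := by
  have N0 := hN 3 0 (by norm_num) le_rfl
  have N1 := hN 3 D (by norm_num) hD
  refine ⟨2 * N 3 0 + N 3 D + D, by linarith, ?_⟩
  intro X _ _ hX x y z₁ z₂ γ₁ γ₂ γ₃ γ₄ hxy h1 m1 h2 m2 h3 h4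
  obtain ⟨A1, A3⟩ := tmr_core N hN D hX x y z₁ z₂ γ₁ γ₂ γ₃ hxy h1 m1 h2 m2 h3
  obtain ⟨r, re⟩ := tmr_rev γ₃ z₁ z₂ h3
  obtain ⟨A2, -⟩ := tmr_core N hN D hX y x z₂ z₁ γ₂ γ₁ _ (by rwa [dist_comm]) h2 m2 h1 m1 r
  rw [re] at A2
  have x1 : x ∈ segImage γ₁ x z₁ := ⟨0, ⟨le_rfl, dist_nonneg⟩, h1.1⟩
  have y2 : y ∈ segImage γ₂ y z₂ := ⟨0, ⟨le_rfl, dist_nonneg⟩, h2.1⟩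
  refine ⟨fun w hw => ?_, fun w hw => ?_, fun w hw => ?_, ?_⟩
  · exact (infDist_le_infDist_of_subset subset_union_left ⟨y, Or.inl y2⟩).trans (A1 w hw)
  · exact (infDist_le_infDist_of_subset subset_union_left ⟨x, Or.inl x1⟩).trans (A2 w hw)
  · exact (infDist_le_infDist_of_subset subset_union_left ⟨x, Or.inl x1⟩).trans (A3 w hw)
  · rintro _ ⟨t, ht, rfl⟩
    have a := h4.2.2 t ht 0 ⟨le_rfl, dist_nonneg⟩
    rw [h4.1, sub_zero, abs_of_nonneg ht.1] at a
    have b := infDist_le_dist_of_mem (x := γ₄ t)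
      (show x ∈ segImage γ₁ x z₁ ∪ segImage γ₂ y z₂ ∪ segImage γ₃ z₁ z₂ from Or.inl (Or.inl x1))
    linarith [ht.2]
end

section
/- The Busemann function of a Morse ray is Morse convex: let X be a proper geodesic metric space, N a Morse gauge, c an N-Morse geodesic ray in X, and b : X → ℝ its Busemann function (i.e., for every x ∈ X, d(x, c(t)) − t → b(x) as t → ∞). Then for every pair of N-Morse geodesic rays g₁, g₂ in X there exists K ≥ 0 such that for all x₀ in the image of g₁, x₁ in the image of g₂, every geodesic segment γ from x₀ to x₁, and every t ∈ [0,1], b(γ(t·d(x₀,x₁))) ≤ (1−t)·b(x₀) + t·b(x₁) + K. -/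
lemma morse_perturb {X : Type*} [MetricSpace X] {N : ℝ → ℝ → ℝ} {A : Set X}
    (hA : IsMorseSet N A) {lam eps a b R : ℝ} {σ : ℝ → X} (hl : 1 ≤ lam) (he : 0 ≤ eps)
    (hab : a ≤ b) (hR : 0 ≤ R) (hσ : IsQuasiGeodesicOn lam eps a b σ) {y z : X} (hy : y ∈ A)
    (hz : z ∈ A) (hya : dist (σ a) y ≤ R) (hzb : dist (σ b) z ≤ R) :
    ∀ s ∈ Set.Icc a b, ∃ w ∈ A, dist (σ s) w ≤ N lam (eps + 2 * R) + R + 1 := by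
  classical
  intro s hs
  let σ' : ℝ → X := fun s => if s = a then y else if s = b then z else σ s
  have hd : ∀ s, dist (σ s) (σ' s) ≤ R := by
    intro s
    by_cases h1 : s = a
    · simp [σ', h1, hya]
    · by_cases h2 : s = b
      · subst h2
        simp [σ', h1, hzb]
      · simp [σ', h1, h2, hR]
  have hq : IsQuasiGeodesicOn lam (eps + 2 * R) a b σ' := by
    intro s hs t ht
    have h := hσ s hs t ht
    have h1 := hd s
    have h2 := hd t
    have h3 := dist_triangle4 (σ s) (σ' s) (σ' t) (σ t)
    have h4 := dist_triangle4 (σ' s) (σ s) (σ t) (σ' t)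
    rw [dist_comm (σ' t) (σ t)] at h3
    rw [dist_comm (σ' s) (σ s)] at h4
    constructor <;> linarith [h.1, h.2]
  have h := hA lam (eps + 2 * R) a b σ' hl (by linarith) hab hq (by simp [σ', hy])
    (by by_cases h : b = a <;> simp [σ', h, hy, hz]) s hs
  obtain ⟨w, hw, hw2⟩ := (Metric.infDist_lt_iff ⟨y, hy⟩).1 (lt_of_le_of_lt h (lt_add_one _))
  refine ⟨w, hw, ?_⟩
  linarith [dist_triangle (σ s) (σ' s) w, hd s]

lemma concat_qg {X : Type*} [MetricSpace X] {α β : ℝ → X} {a l : ℝ}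
    (hα : ∀ s ∈ Set.Icc 0 a, ∀ t ∈ Set.Icc 0 a, dist (α s) (α t) = |s - t|)
    (hβ : ∀ s ∈ Set.Icc 0 l, ∀ t ∈ Set.Icc 0 l, dist (β s) (β t) = |s - t|)
    (ha : 0 ≤ a) (hl : 0 ≤ l)
    (hj : α a = β 0) (hmin : ∀ t ∈ Set.Icc 0 l, a ≤ dist (α 0) (β t)) :
    IsQuasiGeodesicOn 3 0 0 (a + l) (fun s => if s ≤ a then α s else β (s - a)) := by
  have key : ∀ s ∈ Set.Icc 0 a, ∀ t ∈ Set.Icc 0 l,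
      (a - s + t) / 3 ≤ dist (α s) (β t) ∧ dist (α s) (β t) ≤ a - s + t := by
    intro s hs t ht
    have h1 := hα s hs a ⟨ha, le_rfl⟩
    have h2 := hβ 0 ⟨le_rfl, hl⟩ t ht
    have h3 := hα 0 ⟨le_rfl, ha⟩ s hs
    rw [abs_sub_comm, abs_of_nonneg (by linarith [hs.2])] at h1
    rw [abs_sub_comm, abs_of_nonneg (by linarith [ht.1])] at h2
    rw [abs_sub_comm, abs_of_nonneg (by linarith [hs.1])] at h3
    have h4 := hmin t ht
    rw [hj] at h1
    have h5 := dist_triangle (α s) (β 0) (β t)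
    have h6 := dist_triangle (β 0) (α s) (β t)
    rw [dist_comm (β 0) (α s)] at h6
    have h7 := dist_triangle (α 0) (α s) (β t)
    constructor <;> linarith
  intro s hs t ht
  obtain ⟨hs0, hs1⟩ := hs
  obtain ⟨ht0, ht1⟩ := ht
  have hn := abs_nonneg (s - t)
  by_cases h1 : s ≤ a <;> by_cases h2 : t ≤ a
  · simp only [h1, h2, if_true]
    rw [hα s ⟨hs0, h1⟩ t ⟨ht0, h2⟩]
    constructor <;> linarith
  · simp only [h1, h2, if_true, if_false]
    have h := key s ⟨hs0, h1⟩ (t - a) ⟨by linarith, by linarith⟩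
    rw [abs_sub_comm, abs_of_nonneg (by linarith : (0:ℝ) ≤ t - s)]
    constructor <;> linarith [h.1, h.2]
  · simp only [h1, h2, if_true, if_false]
    have h := key t ⟨ht0, h2⟩ (s - a) ⟨by linarith, by linarith⟩
    rw [dist_comm, abs_of_nonneg (by linarith : (0:ℝ) ≤ s - t)]
    constructor <;> linarith [h.1, h.2]
  · simp only [h1, h2, if_false]
    rw [hβ (s - a) ⟨by linarith, by linarith⟩ (t - a) ⟨by linarith, by linarith⟩]
    rw [show s - a - (t - a) = s - t by ring]
    constructor <;> linarith

lemma exists_nearest {X : Type*} [MetricSpace X] {γ : ℝ → X} {x y : X}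
    (h : IsGeodesicSegment γ x y) (o : X) :
    ∃ s ∈ Set.Icc 0 (dist x y), ∀ t ∈ Set.Icc 0 (dist x y), dist o (γ s) ≤ dist o (γ t) := by
  have hc : ContinuousOn γ (Set.Icc 0 (dist x y)) := by
    have : LipschitzOnWith 1 γ (Set.Icc 0 (dist x y)) := by
      apply LipschitzOnWith.of_dist_le_mul
      intro s hs t ht
      rw [h.2.2 s hs t ht, Real.dist_eq]
      simp
    exact this.continuousOn
  obtain ⟨s, hs, hm⟩ := isCompact_Icc.exists_isMinOn (⟨0, le_rfl, dist_nonneg⟩ :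
    (Set.Icc 0 (dist x y)).Nonempty) (by fun_prop : ContinuousOn
      (fun t => dist o (γ t)) (Set.Icc 0 (dist x y)))
  exact ⟨s, hs, fun t ht => hm ht⟩

lemma ray_compare {X : Type*} [MetricSpace X] {g : ℝ → X} (hg : IsGeodesicRay g) {s S R K : ℝ}
    (hs : 0 ≤ s) {o p : X} (ho : dist o (g 0) ≤ R) (hp : dist p (g s) ≤ K)
    (hS : dist o p = S) : |s - S| ≤ K + R := by
  have h := hg 0 s le_rfl hs
  rw [abs_sub_comm, sub_zero, abs_of_nonneg hs] at h
  have h1 := dist_triangle4 (g 0) o p (g s)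
  have h2 := dist_triangle4 o (g 0) (g s) p
  rw [dist_comm (g 0) o] at h1
  rw [dist_comm (g s) p] at h2
  rw [abs_le]
  constructor <;> linarith

lemma dichotomy {X : Type*} [MetricSpace X]
    (hX : IsGeodesicSpace X) (N : ℝ → ℝ → ℝ) (g h : ℝ → X)
    (hg : IsGeodesicRay g) (hgM : IsMorseSet N (g '' Set.Ici (0 : ℝ)))
    (hh : IsGeodesicRay h) (hhM : IsMorseSet N (h '' Set.Ici (0 : ℝ))) :
    (∃ K, ∀ u, 0 ≤ u → dist (g u) (h u) ≤ K) ∨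
    (∃ K, ∀ u v, 0 ≤ u → 0 ≤ v → ∀ γ : ℝ → X, IsGeodesicSegment γ (g u) (h v) →
      ∃ s ∈ Set.Icc 0 (dist (g u) (h v)), dist (g 0) (γ s) ≤ K) := by
  by_cases hB : (∃ K, ∀ u v, 0 ≤ u → 0 ≤ v → ∀ γ : ℝ → X, IsGeodesicSegment γ (g u) (h v) →
      ∃ s ∈ Set.Icc 0 (dist (g u) (h v)), dist (g 0) (γ s) ≤ K)
  · exact Or.inr hB
  left
  push Not at hB
  set R := dist (g 0) (h 0) with hRdef
  have hR : 0 ≤ R := dist_nonneg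
  obtain ⟨K3, hK3⟩ : ∃ K3, ∀ M, ∃ s, M ≤ s ∧ 0 ≤ s ∧ dist (g s) (h s) ≤ K3 := by
    set K1 := N 3 (0 + 2 * 0) + 0 + 1
    set K2 := N 3 (0 + 2 * R) + R + 1
    refine ⟨2 * K1 + 2 * K2 + R, fun M => ?_⟩
    obtain ⟨u, v, hu, hv, γ, hγ, hfar⟩ := hB (M + K1)
    obtain ⟨s0, hs0, hmin⟩ := exists_nearest hγ (g 0)
    have hfar := hfar s0 hs0
    obtain ⟨α, hα0, hα1, hα⟩ := hX (g 0) (γ s0)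
    set S := dist (g 0) (γ s0) with hS
    have hS0 : 0 ≤ S := dist_nonneg
    obtain ⟨hγ0, hγ1, hγi⟩ := hγ
    set D := dist (g u) (h v)
    obtain ⟨hs00, hs01⟩ := hs0
    have q1 := concat_qg (α := α) (β := fun t => γ (s0 - t)) (a := S) (l := s0) hα
      (by
        intro s hs t ht
        rw [hγi _ ⟨by linarith [hs.2], by linarith [hs.1]⟩ _ ⟨by linarith [ht.2], by linarith [ht.1]⟩,
          show s0 - s - (s0 - t) = t - s by ring, abs_sub_comm]) hS0 hs00
      (by simp [hα1]) (by
        intro t ht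
        rw [hα0]
        exact hmin _ ⟨by linarith [ht.2], by linarith [ht.1]⟩)
    have q2 := concat_qg (α := α) (β := fun t => γ (s0 + t)) (a := S) (l := D - s0) hα
      (by
        intro s hs t ht
        rw [hγi _ ⟨by linarith [hs.1], by linarith [hs.2]⟩ _ ⟨by linarith [ht.1], by linarith [ht.2]⟩,
          show s0 + s - (s0 + t) = s - t by ring]) hS0 (by linarith)
      (by simp [hα1]) (by
        intro t ht
        rw [hα0]
        exact hmin _ ⟨by linarith [ht.1], by linarith [ht.2]⟩)
    have e1 : (if S + s0 ≤ S then α (S + s0) else γ (s0 - (S + s0 - S))) = g u := by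
      by_cases hz : S + s0 ≤ S
      · have : s0 = 0 := by linarith
        rw [if_pos hz, this, add_zero, hα1, this, hγ0]
      · rw [if_neg hz, ← hγ0]
        congr 1
        ring
    have e2 : (if S + (D - s0) ≤ S then α (S + (D - s0)) else γ (s0 + (S + (D - s0) - S)))
        = h v := by
      by_cases hz : S + (D - s0) ≤ S
      · have : s0 = D := by linarith
        rw [if_pos hz, this, sub_self, add_zero, hα1, this, hγ1]
      · rw [if_neg hz, ← hγ1]
        congr 1
        ring
    obtain ⟨_, ⟨s, hs, rfl⟩, hps⟩ := morse_perturb hgM (R := 0) (y := g 0) (z := g u)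
      (by norm_num) le_rfl
      (by linarith) le_rfl q1 ⟨0, Set.mem_Ici.2 le_rfl, rfl⟩ ⟨u, hu, rfl⟩
      (by simp [hS0, hα0]) (by rw [e1, dist_self]) S ⟨hS0, by linarith⟩
    obtain ⟨_, ⟨s', hs', rfl⟩, hps'⟩ := morse_perturb hhM (R := R) (y := h 0) (z := h v)
      (by norm_num) le_rfl
      (by linarith) hR q2 ⟨0, Set.mem_Ici.2 le_rfl, rfl⟩ ⟨v, hv, rfl⟩
      (by simp [hS0, hα0, hRdef]) (by rw [e2, dist_self]; exact hR) S ⟨hS0, by linarith⟩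
    simp only [le_refl, if_true, hα1] at hps hps'
    rw [Set.mem_Ici] at hs hs'
    have c1 := ray_compare hg hs (o := g 0) (R := 0) (by simp) hps hS.symm
    have c2 := ray_compare hh hs' (o := g 0) (R := R) le_rfl hps' hS.symm
    have c3 := hh s' s hs' hs
    have c4 : |s' - s| ≤ K1 + (K2 + R) := by
      rw [abs_le] at *
      constructor <;> linarith [c1.1, c1.2, c2.1, c2.2]
    refine ⟨s, by linarith [(abs_le.1 c1).1], hs, ?_⟩
    have c5 := dist_triangle4 (g s) (γ s0) (h s') (h s)
    rw [dist_comm (g s) (γ s0)] at c5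
    linarith
  set K := max K3 R
  set K4 := N 1 (0 + 2 * K) + K + 1
  refine ⟨2 * K4 + R, fun u hu => ?_⟩
  obtain ⟨s, hus, hs, hd⟩ := hK3 u
  obtain ⟨_, ⟨w, hw, rfl⟩, hpw⟩ := morse_perturb hhM (R := K) (y := h 0) (z := h s) (σ := g)
    (a := 0) (b := s) (lam := 1) (eps := 0) le_rfl le_rfl hs (le_trans hR (le_max_right _ _))
    (by
      intro x hx y hy
      rw [hg x y hx.1 hy.1]
      constructor <;> linarith)
    ⟨0, Set.mem_Ici.2 le_rfl, rfl⟩ ⟨s, hs, rfl⟩ (le_max_right _ _) (le_trans hd (le_max_left _ _))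
    u ⟨hu, hus⟩
  have c1 := ray_compare hh hw (o := g 0) (R := R) le_rfl hpw (hg 0 u le_rfl hu)
  rw [abs_sub_comm 0 u, sub_zero, abs_of_nonneg hu] at c1
  have c2 := hh w u hw hu
  linarith [dist_triangle (g u) (h w) (h u)]

lemma center_convex {X : Type*} [MetricSpace X] {b : X → ℝ} (hL : ∀ x y, b x ≤ b y + dist x y)
    {x₀ x₁ : X} {γ : ℝ → X} (hγ : IsGeodesicSegment γ x₀ x₁) {K s : ℝ}
    (hs : s ∈ Set.Icc 0 (dist x₀ x₁)) (h0 : b (γ s) + s ≤ b x₀ + K)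
    (h1 : b (γ s) + (dist x₀ x₁ - s) ≤ b x₁ + K) :
    ∀ t ∈ Set.Icc (0 : ℝ) 1,
      b (γ (t * dist x₀ x₁)) ≤ (1 - t) * b x₀ + t * b x₁ + K := by
  intro t ht
  obtain ⟨ht0, ht1⟩ := ht
  set D := dist x₀ x₁
  have hD : 0 ≤ D := dist_nonneg
  have h2 := hL (γ (t * D)) (γ s)
  rw [hγ.2.2 _ ⟨by positivity, by nlinarith⟩ s hs] at h2
  have h3 : |t * D - s| ≤ (1 - t) * s + t * (D - s) := by
    obtain ⟨a1, a2⟩ := hs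
    rw [abs_le]
    constructor <;> nlinarith [mul_nonneg ht0 a1, mul_nonneg ht0 (sub_nonneg.2 a2),
      mul_nonneg (sub_nonneg.2 ht1) a1, mul_nonneg (sub_nonneg.2 ht1) (sub_nonneg.2 a2)]
  have h4 := mul_le_mul_of_nonneg_left h0 (sub_nonneg.2 ht1)
  have h5 := mul_le_mul_of_nonneg_left h1 ht0
  nlinarith

lemma ray_dist_zero {X : Type*} [MetricSpace X] {g : ℝ → X} (hg : IsGeodesicRay g) {u : ℝ}
    (hu : 0 ≤ u) : dist (g u) (g 0) = u := by
  rw [hg u 0 hu le_rfl, sub_zero, abs_of_nonneg hu]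

/-- the Busemann function of an `N`-Morse geodesic ray is Morse convex: along
geodesic segments joining points of two `N`-Morse rays, it is coarsely convex. -/
theorem busemann_of_morse_ray_is_morse_convex {X : Type*} [MetricSpace X] [ProperSpace X]
    (hX : IsGeodesicSpace X) (N : ℝ → ℝ → ℝ) (hN : IsMorseGauge N) (c : ℝ → X)
    (hc : IsGeodesicRay c) (hcM : IsMorseSet N (c '' Set.Ici (0 : ℝ))) (b : X → ℝ)
    (hb : ∀ x : X, Filter.Tendsto (fun t : ℝ => dist x (c t) - t) Filter.atTop (nhds (b x))) :
    ∀ g₁ g₂ : ℝ → X, IsGeodesicRay g₁ → IsMorseSet N (g₁ '' Set.Ici (0 : ℝ)) →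
      IsGeodesicRay g₂ → IsMorseSet N (g₂ '' Set.Ici (0 : ℝ)) →
      ∃ K : ℝ, 0 ≤ K ∧
        ∀ x₀ ∈ g₁ '' Set.Ici (0 : ℝ), ∀ x₁ ∈ g₂ '' Set.Ici (0 : ℝ), ∀ γ : ℝ → X,
          IsGeodesicSegment γ x₀ x₁ → ∀ t ∈ Set.Icc (0 : ℝ) 1,
            b (γ (t * dist x₀ x₁)) ≤ (1 - t) * b x₀ + t * b x₁ + K := by
  intro g₁ g₂ hg₁ hM₁ hg₂ hM₂
  have hL : ∀ x y, b x ≤ b y + dist x y := by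
    intro x y
    refine le_of_tendsto_of_tendsto' (hb x) ((hb y).add_const (dist x y)) fun t => ?_
    linarith [dist_triangle x y (c t)]
  have hbc : ∀ s, 0 ≤ s → b (c s) = -s := by
    intro s hs
    refine tendsto_nhds_unique (hb (c s)) (tendsto_const_nhds.congr' ?_)
    filter_upwards [Filter.eventually_ge_atTop s] with t ht
    rw [hc s t hs (hs.trans ht), abs_sub_comm, abs_of_nonneg (by linarith)]
    ring
  -- either asymptotic to c, or b grows linearly
  have alt : ∀ g : ℝ → X, IsGeodesicRay g → IsMorseSet N (g '' Set.Ici (0 : ℝ)) →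
      (∃ K, ∀ u, 0 ≤ u → dist (g u) (c u) ≤ K) ∨ (∃ K, ∀ u, 0 ≤ u → u - K ≤ b (g u)) := by
    intro g hg hM
    rcases dichotomy hX N g c hg hM hc hcM with h | ⟨K, hK⟩
    · exact Or.inl h
    right
    refine ⟨2 * K + dist (g 0) (c 0), fun u hu => ?_⟩
    refine ge_of_tendsto (hb (g u)) ?_
    filter_upwards [Filter.eventually_ge_atTop 0] with T hT
    obtain ⟨γ, hγ⟩ := hX (g u) (c T)
    obtain ⟨s, hs, hd⟩ := hK u T hu hT γ hγ
    have h1 := hγ.2.2 0 ⟨le_rfl, dist_nonneg⟩ s hs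
    have h2 := hγ.2.2 s hs _ ⟨dist_nonneg, le_rfl⟩
    rw [hγ.1, abs_sub_comm, sub_zero, abs_of_nonneg hs.1] at h1
    rw [hγ.2.1, abs_sub_comm, abs_of_nonneg (sub_nonneg.2 hs.2)] at h2
    have h3 := ray_dist_zero hg hu
    have h4 := ray_dist_zero hc hT
    have h5 := dist_triangle (g u) (γ s) (g 0)
    have h6 := dist_triangle4 (c T) (γ s) (g 0) (c 0)
    rw [dist_comm (γ s) (g 0)] at h5 h6
    rw [dist_comm (c T) (γ s)] at h6
    linarith
  have hup : ∀ g : ℝ → X, IsGeodesicRay g → ∀ u, 0 ≤ u → b (g u) ≤ b (g 0) + u := by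
    intro g hg u hu
    have := hL (g u) (g 0)
    rwa [ray_dist_zero hg hu] at this
  -- reduce to finding a centre
  suffices hmain : ∃ K : ℝ, ∀ u v, 0 ≤ u → 0 ≤ v → ∀ γ : ℝ → X,
      IsGeodesicSegment γ (g₁ u) (g₂ v) → ∃ s ∈ Set.Icc 0 (dist (g₁ u) (g₂ v)),
        b (γ s) + s ≤ b (g₁ u) + K ∧
          b (γ s) + (dist (g₁ u) (g₂ v) - s) ≤ b (g₂ v) + K by
    obtain ⟨K, hK⟩ := hmain
    refine ⟨max K 0, le_max_right _ _, ?_⟩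
    rintro _ ⟨u, hu, rfl⟩ _ ⟨v, hv, rfl⟩ γ hγ
    obtain ⟨s, hs, h0, h1⟩ := hK u v hu hv γ hγ
    exact center_convex hL hγ hs (h0.trans (by linarith [le_max_left K 0]))
      (h1.trans (by linarith [le_max_left K 0]))
  -- centre at an endpoint
  have hends : ∀ K : ℝ, 0 ≤ K → (∀ u v, 0 ≤ u → 0 ≤ v →
      b (g₁ u) + dist (g₁ u) (g₂ v) ≤ b (g₂ v) + K ∨
      b (g₂ v) + dist (g₁ u) (g₂ v) ≤ b (g₁ u) + K) →
      ∃ K : ℝ, ∀ u v, 0 ≤ u → 0 ≤ v → ∀ γ : ℝ → X,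
      IsGeodesicSegment γ (g₁ u) (g₂ v) → ∃ s ∈ Set.Icc 0 (dist (g₁ u) (g₂ v)),
        b (γ s) + s ≤ b (g₁ u) + K ∧
          b (γ s) + (dist (g₁ u) (g₂ v) - s) ≤ b (g₂ v) + K := by
    intro K hK0 hK
    refine ⟨K, fun u v hu hv γ hγ => ?_⟩
    rcases hK u v hu hv with h | h
    · exact ⟨0, ⟨le_rfl, dist_nonneg⟩, by rw [hγ.1]; linarith, by rw [hγ.1]; linarith⟩
    · exact ⟨_, ⟨dist_nonneg, le_rfl⟩, by rw [hγ.2.1]; linarith, by rw [hγ.2.1]; linarith⟩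
  have tri0 : ∀ u v, 0 ≤ u → 0 ≤ v →
      dist (g₁ u) (g₂ v) ≤ u + dist (g₁ 0) (g₂ 0) + v := by
    intro u v hu hv
    have := dist_triangle4 (g₁ u) (g₁ 0) (g₂ 0) (g₂ v)
    rwa [ray_dist_zero hg₁ hu, dist_comm (g₂ 0), ray_dist_zero hg₂ hv] at this
  have hR : 0 ≤ dist (g₁ 0) (g₂ 0) := dist_nonneg
  rcases alt g₁ hg₁ hM₁ with ⟨K1, h1⟩ | ⟨K1, h1⟩ <;>
    rcases alt g₂ hg₂ hM₂ with ⟨K2, h2⟩ | ⟨K2, h2⟩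
  · have p1 : 0 ≤ K1 := dist_nonneg.trans (h1 0 le_rfl)
    have p2 : 0 ≤ K2 := dist_nonneg.trans (h2 0 le_rfl)
    refine hends (2 * K1 + 2 * K2) (by linarith) fun u v hu hv => ?_
    have a1 := hL (g₁ u) (c u)
    have a2 := hL (g₂ v) (c v)
    have a3 := hL (c u) (g₁ u)
    have a4 := hL (c v) (g₂ v)
    rw [dist_comm] at a3 a4
    rw [hbc u hu] at a1 a3
    rw [hbc v hv] at a2 a4
    have a5 := dist_triangle4 (g₁ u) (c u) (c v) (g₂ v)
    rw [hc u v hu hv, dist_comm (c v)] at a5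
    have b1 := h1 u hu
    have b2 := h2 v hv
    rcases le_total u v with huv | huv
    · right
      rw [abs_sub_comm, abs_of_nonneg (by linarith)] at a5
      linarith
    · left
      rw [abs_of_nonneg (by linarith)] at a5
      linarith
  · refine hends (K1 + |K2| + dist (g₁ 0) (g₂ 0))
      (by linarith [abs_nonneg K2, dist_nonneg.trans (h1 0 le_rfl)]) fun u v hu hv => ?_
    left
    have a1 := hL (g₁ u) (c u)
    rw [hbc u hu] at a1
    linarith [h1 u hu, h2 v hv, tri0 u v hu hv, le_abs_self K2]
  · refine hends (K2 + |K1| + dist (g₁ 0) (g₂ 0))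
      (by linarith [abs_nonneg K1, dist_nonneg.trans (h2 0 le_rfl)]) fun u v hu hv => ?_
    right
    have a1 := hL (g₂ v) (c v)
    rw [hbc v hv] at a1
    linarith [h1 u hu, h2 v hv, tri0 u v hu hv, le_abs_self K1]
  · rcases dichotomy hX N g₁ g₂ hg₁ hM₁ hg₂ hM₂ with ⟨K, hK⟩ | ⟨K, hK⟩
    · have p := dist_nonneg.trans (hK 0 le_rfl)
      refine hends (|K1| + |K2| + |b (g₁ 0)| + |b (g₂ 0)| + K) (by positivity)
        fun u v hu hv => ?_
      have b1 := hup g₁ hg₁ u hu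
      have b2 := hup g₂ hg₂ v hv
      have b3 := h1 u hu
      have b4 := h2 v hv
      have a5 := dist_triangle (g₁ u) (g₂ u) (g₂ v)
      rw [hg₂ u v hu hv] at a5
      have b5 := hK u hu
      have l1 := le_abs_self K1
      have l2 := le_abs_self K2
      have l3 := le_abs_self (b (g₁ 0))
      have l4 := le_abs_self (b (g₂ 0))
      have m1 := abs_nonneg K1
      have m2 := abs_nonneg K2
      have m3 := abs_nonneg (b (g₁ 0))
      have m4 := abs_nonneg (b (g₂ 0))
      rcases le_total u v with huv | huv
      · left
        rw [abs_sub_comm, abs_of_nonneg (by linarith)] at a5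
        linarith
      · right
        rw [abs_of_nonneg (by linarith)] at a5
        linarith
    · refine ⟨|K1| + |K2| + |b (g₁ 0)| + 2 * |K| + dist (g₁ 0) (g₂ 0), fun u v hu hv γ hγ => ?_⟩
      obtain ⟨s, hs, hd⟩ := hK u v hu hv γ hγ
      refine ⟨s, hs, ?_⟩
      have e1 := hγ.2.2 0 ⟨le_rfl, dist_nonneg⟩ s hs
      have e2 := hγ.2.2 s hs _ ⟨dist_nonneg, le_rfl⟩
      rw [hγ.1, abs_sub_comm, sub_zero, abs_of_nonneg hs.1] at e1
      rw [hγ.2.1, abs_sub_comm, abs_of_nonneg (sub_nonneg.2 hs.2)] at e2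
      have e3 := ray_dist_zero hg₁ hu
      have e4 := ray_dist_zero hg₂ hv
      have e5 := dist_triangle (g₁ u) (g₁ 0) (γ s)
      have e6 := dist_triangle4 (γ s) (g₁ 0) (g₂ 0) (g₂ v)
      have e7 := hL (γ s) (g₁ 0)
      rw [dist_comm (γ s) (g₁ 0), dist_comm (g₂ 0)] at e6
      rw [dist_comm (γ s) (g₁ 0)] at e7
      have b3 := h1 u hu
      have b4 := h2 v hv
      have l1 := le_abs_self K1
      have l2 := le_abs_self K2
      have l3 := le_abs_self (b (g₁ 0))
      have l4 := le_abs_self K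
      have m1 := abs_nonneg K1
      have m2 := abs_nonneg K2
      constructor <;> linarith
end
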